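/- (Maximal-in-time estimate for the Benjamin–Ono group) For every φ ∈ S(ℝ) and every T > 0, ‖D_x^{−1/4} V(t) φ‖_{L^4_x L^∞_T} ≲ ‖φ‖_{L²(ℝ)}, with implicit constant independent of φ and T. -/

import Mathlib

open MeasureTheory Real Set Filter
open scoped FourierTransform ENNReal NNReal Topology

noncomputable section

/-- Fourier multiplier operator with symbol `m`. -/
def FMul (m : ℝ → ℂ) (f : ℝ → ℂ) : ℝ → ℂ :=
  𝓕⁻ fun ξ => m ξ * 𝓕 f ξ

/-- `D_x^α`, the Fourier multiplier with symbol `|ξ|^α`. -/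
def Dop (α : ℝ) (f : ℝ → ℂ) : ℝ → ℂ :=
  FMul (fun ξ => ((|ξ| ^ α : ℝ) : ℂ)) f

/-- The free Benjamin–Ono group `V(t) = 𝓕⁻¹ e^{itξ|ξ|} 𝓕`. -/
def BOGroup (t : ℝ) (f : ℝ → ℂ) : ℝ → ℂ :=
  FMul (fun ξ => Complex.exp (Complex.I * (t * ξ * |ξ|))) f

/-- The derivative `∂ₓ` as the Fourier multiplier with symbol `iξ`. -/
def Dx1 (f : ℝ → ℂ) : ℝ → ℂ :=
  FMul (fun ξ => Complex.I * ξ) f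

/-- Projection on nonnegative frequencies. -/
def Pplus (f : ℝ → ℂ) : ℝ → ℂ :=
  FMul (fun ξ => if 0 ≤ ξ then 1 else 0) f

/-- Projection on nonpositive frequencies. -/
def Pminus (f : ℝ → ℂ) : ℝ → ℂ :=
  FMul (fun ξ => if ξ ≤ 0 then 1 else 0) f

/-- The Sobolev `H^s` norm. -/
def HsNorm (s : ℝ) (f : ℝ → ℂ) : ℝ≥0∞ :=
  eLpNorm (fun ξ => (((1 + ξ ^ 2) ^ (s / 2) : ℝ) : ℂ) * 𝓕 f ξ) 2 volume

/-- The mixed space-time norm `L^p_x L^q_T`. -/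
def LpLq (p q : ℝ≥0∞) (T : ℝ) (f : ℝ → ℝ → ℂ) : ℝ≥0∞ :=
  eLpNorm (fun x => (eLpNorm (fun t => f x t) q (volume.restrict (Ioc (0:ℝ) T))).toReal) p volume

/-- The mixed space-time norm `L^q_T L^p_x`. -/
def LqLp (q p : ℝ≥0∞) (T : ℝ) (f : ℝ → ℝ → ℂ) : ℝ≥0∞ :=
  eLpNorm (fun t => (eLpNorm (fun x => f x t) p volume).toReal) q (volume.restrict (Ioc (0:ℝ) T))

/-- The norm `L^∞_T H^s_x`. -/
def LinfHs (s : ℝ) (T : ℝ) (f : ℝ → ℝ → ℂ) : ℝ≥0∞ :=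
  eLpNorm (fun t => (HsNorm s (fun x => f x t)).toReal) ∞ (volume.restrict (Ioc (0:ℝ) T))

/-- Apply a spatial operator slice-wise in time. -/
def sliceOp (A : (ℝ → ℂ) → (ℝ → ℂ)) (f : ℝ → ℝ → ℂ) : ℝ → ℝ → ℂ :=
  fun x t => A (fun y => f y t) x

/-- A smooth nonnegative bump `η` supported in `{1/2 ≤ |ξ| ≤ 2}` giving a dyadic
partition of unity `Σ_k η(2^{-k} ξ) = 1` for `ξ ≠ 0`. -/
structure IsLPBump (η : ℝ → ℝ) : Prop where
  smooth : ContDiff ℝ (⊤ : ℕ∞) η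
  nonneg : ∀ ξ, 0 ≤ η ξ
  support : ∀ ξ, η ξ ≠ 0 → 1/2 ≤ |ξ| ∧ |ξ| ≤ 2
  partition : ∀ ξ : ℝ, ξ ≠ 0 → ∑' k : ℤ, η ((2:ℝ) ^ (-k) * ξ) = 1

/-- The low-frequency symbol `p(ξ) = Σ_{j ≤ -3} η(2^{-j} ξ)`. -/
def lowSymbol (η : ℝ → ℝ) (ξ : ℝ) : ℝ :=
  ∑' j : ℤ, if j ≤ -3 then η ((2:ℝ) ^ (-j) * ξ) else 0

/-- The low-frequency projection `P₀`. -/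
def P0 (η : ℝ → ℝ) (f : ℝ → ℂ) : ℝ → ℂ :=
  FMul (fun ξ => ((lowSymbol η ξ : ℝ) : ℂ)) f

/-- The `X^s_T` norm. -/
def XNorm (η : ℝ → ℝ) (s T : ℝ) (u : ℝ → ℝ → ℂ) : ℝ≥0∞ :=
  LinfHs s T u + LpLq ∞ 2 T (sliceOp (Dop (s + 1/2)) u)
    + LpLq 4 ∞ T (sliceOp (Dop (s - 1/4)) u)
    + LpLq 2 ∞ T (sliceOp (P0 η) u)

/-- The Duhamel integral `∫₀ᵗ V(t-τ) f(τ) dτ`. -/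
def duhamel (f : ℝ → ℝ → ℂ) : ℝ → ℝ → ℂ :=
  fun x t => ∫ τ in Ioc (0:ℝ) t, BOGroup (t - τ) (fun y => f y τ) x

/-- van der Corput's first derivative test with increasing derivative. -/
lemma norm_integral_cexp_le_of_deriv_ge {P P' P'' : ℝ → ℝ} {a b l : ℝ} (hab : a ≤ b) (hl : 0 < l)
    (hP : ∀ x, HasDerivAt P (P' x) x) (hP' : ∀ x, HasDerivAt P' (P'' x) x)
    (hc : Continuous P'') (hnn : ∀ x ∈ Icc a b, 0 ≤ P'' x) (hlow : ∀ x ∈ Icc a b, l ≤ P' x) :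
    ‖∫ x in a..b, Complex.exp (P x * Complex.I)‖ ≤ 3 / l := by
  have hcP' : Continuous P' := continuous_iff_continuousAt.2 fun x => (hP' x).continuousAt
  have hcP : Continuous P := continuous_iff_continuousAt.2 fun x => (hP x).continuousAt
  have huI : uIcc a b = Icc a b := uIcc_of_le hab
  have hpos : ∀ x ∈ uIcc a b, 0 < P' x := fun x hx => hl.trans_le (hlow x (huI ▸ hx))
  have hneC : ∀ x ∈ uIcc a b, (P' x : ℂ) * Complex.I ≠ 0 := fun x hx =>
    mul_ne_zero (Complex.ofReal_ne_zero.2 (hpos x hx).ne') Complex.I_ne_zero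
  have hE : ∀ x, HasDerivAt (fun x => Complex.exp (P x * Complex.I))
      (Complex.exp (P x * Complex.I) * (P' x * Complex.I)) x := fun x =>
    ((hP x).ofReal_comp.mul_const Complex.I).cexp
  have hu : ∀ x ∈ uIcc a b, HasDerivAt (fun x => ((P' x : ℂ) * Complex.I)⁻¹)
      (-((P'' x : ℂ) * Complex.I) / ((P' x : ℂ) * Complex.I) ^ 2) x := fun x hx =>
    ((hP' x).ofReal_comp.mul_const Complex.I).inv (hneC x hx)
  have hcu : ContinuousOn (fun x => -((P'' x : ℂ) * Complex.I) / ((P' x : ℂ) * Complex.I) ^ 2)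
      (uIcc a b) :=
    ContinuousOn.div (by fun_prop) (by fun_prop) fun x hx => pow_ne_zero 2 (hneC x hx)
  have hreal : ∀ x ∈ uIcc a b, HasDerivAt (fun x => -(P' x)⁻¹) (P'' x / P' x ^ 2) x := by
    intro x hx
    have := ((hP' x).inv (hpos x hx).ne').neg
    exact this.congr_deriv (by rw [neg_div, neg_neg])
  have hcr : ContinuousOn (fun x => P'' x / P' x ^ 2) (uIcc a b) :=
    ContinuousOn.div (by fun_prop) (by fun_prop) fun x hx => pow_ne_zero 2 (hpos x hx).ne'
  have hparts := intervalIntegral.integral_mul_deriv_eq_deriv_mul (a := a) (b := b) hu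
    (fun x _ => hE x) hcu.intervalIntegrable (Continuous.intervalIntegrable (by fun_prop) _ _)
  have hlhs : ∫ x in a..b, Complex.exp (P x * Complex.I) =
      ∫ x in a..b, ((P' x : ℂ) * Complex.I)⁻¹ *
        (Complex.exp (P x * Complex.I) * (P' x * Complex.I)) := by
    refine intervalIntegral.integral_congr fun x hx => ?_
    have := hneC x hx
    change _ = _ * (_ * _)
    rw [mul_comm (Complex.exp _), ← mul_assoc, inv_mul_cancel₀ this, one_mul]
  have hinv : ∀ x ∈ uIcc a b, (P' x)⁻¹ ≤ l⁻¹ := fun x hx =>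
    inv_anti₀ hl (hlow x (huI ▸ hx))
  have hbd : ∀ x ∈ uIcc a b,
      ‖((P' x : ℂ) * Complex.I)⁻¹ * Complex.exp (P x * Complex.I)‖ ≤ l⁻¹ := by
    intro x hx
    rw [norm_mul, Complex.norm_exp_ofReal_mul_I, mul_one, norm_inv, norm_mul, Complex.norm_I,
      mul_one, Complex.norm_real, Real.norm_of_nonneg (hpos x hx).le]
    exact hinv x hx
  have hint : ‖∫ x in a..b, -((P'' x : ℂ) * Complex.I) / ((P' x : ℂ) * Complex.I) ^ 2 *
      Complex.exp (P x * Complex.I)‖ ≤ ∫ x in a..b, P'' x / P' x ^ 2 := by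
    refine intervalIntegral.norm_integral_le_of_norm_le hab (ae_of_all _ fun x hx => ?_)
      hcr.intervalIntegrable
    have hx' : x ∈ Icc a b := Ioc_subset_Icc_self hx
    rw [norm_mul, Complex.norm_exp_ofReal_mul_I, mul_one, norm_div, norm_neg, norm_pow, norm_mul,
      norm_mul, Complex.norm_I, mul_one, mul_one, Complex.norm_real, Complex.norm_real,
      Real.norm_of_nonneg (hnn x hx'), Real.norm_of_nonneg (hpos x (huI ▸ hx')).le]
  rw [intervalIntegral.integral_eq_sub_of_hasDerivAt hreal hcr.intervalIntegrable] at hint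
  have ha := hbd a left_mem_uIcc
  have hb := hbd b right_mem_uIcc
  have ha' := hinv a left_mem_uIcc
  have hb' : 0 ≤ (P' b)⁻¹ := (inv_pos.2 (hpos b right_mem_uIcc)).le
  rw [hlhs, hparts]
  calc _ ≤ l⁻¹ + l⁻¹ + l⁻¹ := by
        refine (norm_sub_le _ _).trans (add_le_add ((norm_sub_le _ _).trans (add_le_add hb ha)) ?_)
        linarith
    _ = 3 / l := by ring

lemma norm_integral_cexp_le_length (P : ℝ → ℝ) {a b : ℝ} (hab : a ≤ b) :
    ‖∫ x in a..b, Complex.exp (P x * Complex.I)‖ ≤ b - a := by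
  have := intervalIntegral.norm_integral_le_of_norm_le_const (a := a) (b := b) (C := 1)
    (f := fun x => Complex.exp (P x * Complex.I)) fun x _ => by
      rw [Complex.norm_exp_ofReal_mul_I]
  rwa [one_mul, abs_of_nonneg (sub_nonneg.2 hab)] at this

lemma norm_integral_cexp_le_of_deriv_ge_linear {P P' P'' : ℝ → ℝ} {a b l z : ℝ} (hab : a ≤ b)
    (hl : 0 < l) (hza : z ≤ a)
    (hP : ∀ x, HasDerivAt P (P' x) x) (hP' : ∀ x, HasDerivAt P' (P'' x) x)
    (hc : Continuous P'') (hnn : ∀ x ∈ Icc a b, 0 ≤ P'' x)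
    (hlow : ∀ x ∈ Icc a b, l ^ 2 * (x - z) ≤ P' x) :
    ‖∫ x in a..b, Complex.exp (P x * Complex.I)‖ ≤ 4 / l := by
  have hcP : Continuous P := continuous_iff_continuousAt.2 fun x => (hP x).continuousAt
  have hli : 0 < l⁻¹ := inv_pos.2 hl
  have hdiv : 4 / l = l⁻¹ + 3 / l := by ring
  rcases le_total b (a + l⁻¹) with h | h
  · refine (norm_integral_cexp_le_length P hab).trans ?_
    have : 0 ≤ 3 / l := by positivity
    linarith
  · have hi : ∀ u v, IntervalIntegrable (fun x => Complex.exp (P x * Complex.I)) volume u v :=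
      fun u v => Continuous.intervalIntegrable (by fun_prop) _ _
    rw [← intervalIntegral.integral_add_adjacent_intervals (hi a (a + l⁻¹)) (hi _ b), hdiv]
    refine (norm_add_le _ _).trans (add_le_add ?_ ?_)
    · have := norm_integral_cexp_le_length P (a := a) (b := a + l⁻¹) (by linarith)
      linarith
    · refine norm_integral_cexp_le_of_deriv_ge h hl hP hP' hc
        (fun x hx => hnn x ⟨by linarith [hx.1], hx.2⟩) fun x hx => ?_
      have h1 := hlow x ⟨by linarith [hx.1], hx.2⟩
      have h2 : l ^ 2 * l⁻¹ ≤ l ^ 2 * (x - z) :=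
        mul_le_mul_of_nonneg_left (by linarith [hx.1]) (by positivity)
      have h3 : l ^ 2 * l⁻¹ = l := by field_simp
      linarith

lemma norm_integral_cexp_neg (P : ℝ → ℝ) (a b : ℝ) :
    ‖∫ x in a..b, Complex.exp ((-P x : ℝ) * Complex.I)‖ =
      ‖∫ x in a..b, Complex.exp (P x * Complex.I)‖ := by
  rw [← Complex.norm_conj (∫ x in a..b, Complex.exp (P x * Complex.I)),
    ← intervalIntegral.intervalIntegral_conj]
  congr 1
  refine intervalIntegral.integral_congr fun x _ => ?_
  simp [← Complex.exp_conj]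

/-- The quartic phase obtained from the Benjamin–Ono phase by the substitution `ξ = u²`. -/
def quarticPhase (x t u : ℝ) : ℝ := x * u ^ 2 + t * u ^ 4

def quarticPhaseDeriv (x t u : ℝ) : ℝ := 2 * x * u + 4 * t * u ^ 3

def quarticPhaseDeriv2 (x t u : ℝ) : ℝ := 2 * x + 12 * t * u ^ 2

lemma hasDerivAt_quarticPhase (x t u : ℝ) :
    HasDerivAt (quarticPhase x t) (quarticPhaseDeriv x t u) u := by
  have := ((hasDerivAt_pow 2 u).const_mul x).add ((hasDerivAt_pow 4 u).const_mul t)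
  exact this.congr_deriv (by simp only [quarticPhaseDeriv]; push_cast; ring)

lemma hasDerivAt_quarticPhaseDeriv (x t u : ℝ) :
    HasDerivAt (quarticPhaseDeriv x t) (quarticPhaseDeriv2 x t u) u := by
  have := ((hasDerivAt_id' u).const_mul (2 * x)).add ((hasDerivAt_pow 3 u).const_mul (4 * t))
  exact this.congr_deriv (by simp only [quarticPhaseDeriv2]; push_cast; ring)

lemma continuous_quarticPhase (x t : ℝ) : Continuous (quarticPhase x t) := by
  unfold quarticPhase; fun_prop

lemma continuous_quarticPhaseDeriv2 (x t : ℝ) : Continuous (quarticPhaseDeriv2 x t) := by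
  unfold quarticPhaseDeriv2; fun_prop

lemma norm_integral_quarticPhase_le_left {x t b : ℝ} (hx : 0 < x) (hb : 0 ≤ b)
    (h : 0 ≤ x + 6 * t * b ^ 2) :
    ‖∫ u in (0 : ℝ)..b, Complex.exp (quarticPhase x t u * Complex.I)‖ ≤ 4 / √x := by
  have key : ∀ u ∈ Icc 0 b, 0 ≤ x + 6 * t * u ^ 2 := by
    intro u hu
    have h2 : u ^ 2 ≤ b ^ 2 := pow_le_pow_left₀ hu.1 hu.2 2
    rcases le_total 0 t with ht | ht
    · positivity
    · nlinarith
  refine norm_integral_cexp_le_of_deriv_ge_linear hb (Real.sqrt_pos.2 hx) le_rfl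
    (hasDerivAt_quarticPhase x t) (hasDerivAt_quarticPhaseDeriv x t)
    (continuous_quarticPhaseDeriv2 x t) (fun u hu => ?_) fun u hu => ?_
  · have := key u hu
    simp only [quarticPhaseDeriv2]; linarith
  · have := mul_nonneg hu.1 (key u hu)
    rw [Real.sq_sqrt hx.le]
    simp only [quarticPhaseDeriv]
    nlinarith [mul_nonneg hx.le hu.1]

lemma norm_integral_quarticPhase_le_middle {x t c z b : ℝ} (hx : 0 < x) (hc : 0 < c)
    (hcb : c ≤ b) (hbz : b ≤ z) (hxc : x + 6 * t * c ^ 2 = 0) (hxz : x + 2 * t * z ^ 2 = 0) :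
    ‖∫ u in c..b, Complex.exp (quarticPhase x t u * Complex.I)‖ ≤ 4 / √x := by
  have ht : t < 0 := by
    by_contra! h
    have : 0 ≤ 6 * t * c ^ 2 := by positivity
    linarith
  rw [← neg_neg b, ← neg_neg c, ← intervalIntegral.integral_comp_neg
    (fun u => Complex.exp (quarticPhase x t u * Complex.I))]
  have hev : ∀ u, quarticPhase x t (-u) = quarticPhase x t u := fun u => by
    simp only [quarticPhase]; ring
  simp only [hev]
  rw [← norm_integral_cexp_neg]
  refine norm_integral_cexp_le_of_deriv_ge_linear (z := -z) (by linarith) (Real.sqrt_pos.2 hx)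
    (by linarith)
    (fun u => (hasDerivAt_quarticPhase x t u).neg) (fun u => (hasDerivAt_quarticPhaseDeriv x t u).neg)
    (continuous_quarticPhaseDeriv2 x t).neg (fun u hu => ?_) fun u hu => ?_
  · have : c ^ 2 ≤ u ^ 2 := by nlinarith [hu.1, hu.2]
    simp only [quarticPhaseDeriv2]; nlinarith
  · obtain ⟨v, rfl⟩ : ∃ v, u = -v := ⟨-u, by simp⟩
    obtain ⟨h1, h2⟩ := hu
    have hcv : c ≤ v := by linarith
    have hvz : v ≤ z := by linarith
    rw [Real.sq_sqrt hx.le]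
    simp only [quarticPhaseDeriv]
    have e1 : x = -(2 * t * z ^ 2) := by linarith
    have e2 : -(2 * x * -v + 4 * t * (-v) ^ 3) = 4 * (-t) * (v * (z + v)) * (z - v) := by
      rw [e1]; ring
    have e3 : x ≤ 4 * (-t) * (v * (z + v)) := by
      have : c * (2 * c) ≤ v * (z + v) := by
        apply mul_le_mul hcv (by linarith) (by linarith) (by linarith)
      nlinarith
    rw [e2]
    have := mul_le_mul_of_nonneg_right e3 (by linarith : 0 ≤ z - v)
    linarith

lemma norm_integral_quarticPhase_le_right {x t z b : ℝ} (hx : 0 < x) (hz : 0 < z)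
    (hzb : z ≤ b) (hxz : x + 2 * t * z ^ 2 = 0) :
    ‖∫ u in z..b, Complex.exp (quarticPhase x t u * Complex.I)‖ ≤ 4 / √x := by
  have ht : t < 0 := by
    by_contra! h
    have : 0 ≤ 2 * t * z ^ 2 := by positivity
    linarith
  rw [← norm_integral_cexp_neg]
  refine norm_integral_cexp_le_of_deriv_ge_linear hzb (Real.sqrt_pos.2 hx) le_rfl
    (fun u => (hasDerivAt_quarticPhase x t u).neg) (fun u => (hasDerivAt_quarticPhaseDeriv x t u).neg)
    (continuous_quarticPhaseDeriv2 x t).neg (fun u hu => ?_) fun u hu => ?_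
  · have : z ^ 2 ≤ u ^ 2 := by nlinarith [hu.1, hu.2]
    simp only [quarticPhaseDeriv2]; nlinarith
  · obtain ⟨h1, h2⟩ := hu
    rw [Real.sq_sqrt hx.le]
    simp only [quarticPhaseDeriv]
    have e1 : x = -(2 * t * z ^ 2) := by linarith
    have e2 : -(2 * x * u + 4 * t * u ^ 3) = 4 * (-t) * (u * (u + z)) * (u - z) := by
      rw [e1]; ring
    have e3 : x ≤ 4 * (-t) * (u * (u + z)) := by
      have : z * (2 * z) ≤ u * (u + z) := by
        apply mul_le_mul h1 (by linarith) (by linarith) (by linarith)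
      nlinarith
    rw [e2]
    exact mul_le_mul_of_nonneg_right e3 (by linarith : 0 ≤ u - z)

lemma norm_integral_quarticPhase_le_of_pos {x t b : ℝ} (hx : 0 < x) (hb : 0 ≤ b) :
    ‖∫ u in (0 : ℝ)..b, Complex.exp (quarticPhase x t u * Complex.I)‖ ≤ 12 / √x := by
  have hs := Real.sqrt_pos.2 hx
  have hpos : 0 < 4 / √x := by positivity
  have h12 : 12 / √x = 4 / √x + 4 / √x + 4 / √x := by ring
  by_cases h : 0 ≤ x + 6 * t * b ^ 2
  · have := norm_integral_quarticPhase_le_left hx hb h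
    linarith
  push Not at h
  have ht : t < 0 := by
    by_contra! h'
    have : 0 ≤ 6 * t * b ^ 2 := by positivity
    linarith
  have hti : 0 < -t := by linarith
  have hi : ∀ u v, IntervalIntegrable (fun u => Complex.exp (quarticPhase x t u * Complex.I))
      volume u v := fun u v => by
    have := continuous_quarticPhase x t
    exact Continuous.intervalIntegrable (by fun_prop) _ _
  set c := √(x / (6 * -t)) with hc
  set z := √(x / (2 * -t)) with hz
  have hc0 : 0 < c := Real.sqrt_pos.2 (by positivity)
  have hz0 : 0 < z := Real.sqrt_pos.2 (by positivity)
  have hc2 : c ^ 2 = x / (6 * -t) := Real.sq_sqrt (by positivity)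
  have hz2 : z ^ 2 = x / (2 * -t) := Real.sq_sqrt (by positivity)
  have hxc : x + 6 * t * c ^ 2 = 0 := by
    have := ht.ne
    rw [hc2]; field_simp; ring
  have hxz : x + 2 * t * z ^ 2 = 0 := by
    have := ht.ne
    rw [hz2]; field_simp; ring
  have hcb : c ≤ b := by
    refine le_of_not_gt fun hlt => ?_
    have : b ^ 2 ≤ c ^ 2 := pow_le_pow_left₀ hb hlt.le 2
    nlinarith
  have hcz : c ≤ z := by
    refine le_of_not_gt fun hlt => ?_
    have : z ^ 2 ≤ c ^ 2 := pow_le_pow_left₀ hz0.le hlt.le 2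
    nlinarith
  have h1 := norm_integral_quarticPhase_le_left (t := t) hx hc0.le hxc.ge
  rcases le_total b z with hbz | hbz
  · have h2 := norm_integral_quarticPhase_le_middle hx hc0 hcb hbz hxc hxz
    rw [← intervalIntegral.integral_add_adjacent_intervals (hi 0 c) (hi c b)]
    refine (norm_add_le _ _).trans ?_
    linarith
  · have h2 := norm_integral_quarticPhase_le_middle hx hc0 hcz le_rfl hxc hxz
    have h3 := norm_integral_quarticPhase_le_right hx hz0 hbz hxz
    rw [← intervalIntegral.integral_add_adjacent_intervals (hi 0 z) (hi z b),
      ← intervalIntegral.integral_add_adjacent_intervals (hi 0 c) (hi c z)]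
    refine (norm_add_le _ _).trans ?_
    have := norm_add_le (∫ u in (0 : ℝ)..c, Complex.exp (quarticPhase x t u * Complex.I))
      (∫ u in c..z, Complex.exp (quarticPhase x t u * Complex.I))
    linarith

lemma norm_integral_quarticPhase_le {x t a b : ℝ} (hx : x ≠ 0) (ha : 0 ≤ a) (hb : 0 ≤ b) :
    ‖∫ u in a..b, Complex.exp (quarticPhase x t u * Complex.I)‖ ≤ 24 / √|x| := by
  have h0 : ∀ d : ℝ, 0 ≤ d →
      ‖∫ u in (0 : ℝ)..d, Complex.exp (quarticPhase x t u * Complex.I)‖ ≤ 12 / √|x| := by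
    intro d hd
    rcases lt_or_gt_of_ne hx with h | h
    · rw [abs_of_neg h, ← norm_integral_cexp_neg]
      have hn : ∀ u, -quarticPhase x t u = quarticPhase (-x) (-t) u := fun u => by
        simp only [quarticPhase]; ring
      simp only [hn]
      exact norm_integral_quarticPhase_le_of_pos (by linarith) hd
    · rw [abs_of_pos h]
      exact norm_integral_quarticPhase_le_of_pos h hd
  have hi : ∀ u v, IntervalIntegrable (fun u => Complex.exp (quarticPhase x t u * Complex.I))
      volume u v := fun u v => by
    have := continuous_quarticPhase x t
    exact Continuous.intervalIntegrable (by fun_prop) _ _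
  rw [← intervalIntegral.integral_interval_sub_left (hi 0 b) (hi 0 a)]
  refine (norm_sub_le _ _).trans ?_
  have h24 : 24 / √|x| = 12 / √|x| + 12 / √|x| := by ring
  linarith [h0 a ha, h0 b hb]

/-- Uniform decay of the truncated convolution kernel of `D_x^{-1/2} V(t) P_+`. -/
lemma norm_setIntegral_kernel_le {x t a b : ℝ} (hx : x ≠ 0) (ha : 0 < a) (hab : a ≤ b) :
    ‖∫ ξ in Ioc a b, Complex.exp ((x * ξ + t * ξ ^ 2 : ℝ) * Complex.I) *
      ((ξ ^ (-(1 / 2) : ℝ) : ℝ) : ℂ)‖ ≤ 48 / √|x| := by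
  have hb : 0 < b := ha.trans_le hab
  rw [← intervalIntegral.integral_of_le hab]
  have hsub := intervalIntegral.integral_deriv_smul_comp'' (a := √a) (b := √b)
    (f := fun u => u ^ 2) (f' := fun u => 2 * u)
    (g := fun ξ => Complex.exp ((x * ξ + t * ξ ^ 2 : ℝ) * Complex.I) *
      ((ξ ^ (-(1 / 2) : ℝ) : ℝ) : ℂ)) (by fun_prop)
    (fun u _ => by simpa using (hasDerivAt_pow 2 u).hasDerivWithinAt) (by fun_prop) ?_
  · simp only [Real.sq_sqrt ha.le, Real.sq_sqrt hb.le] at hsub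
    rw [← hsub]
    have hEq : ∫ u in √a..√b, (2 * u) • ((fun ξ : ℝ => Complex.exp ((x * ξ + t * ξ ^ 2 : ℝ) *
        Complex.I) * ((ξ ^ (-(1 / 2) : ℝ) : ℝ) : ℂ)) ∘ fun u => u ^ 2) u =
        2 * ∫ u in √a..√b, Complex.exp (quarticPhase x t u * Complex.I) := by
      rw [← intervalIntegral.integral_const_mul]
      refine intervalIntegral.integral_congr fun u hu => ?_
      rw [uIcc_of_le (Real.sqrt_le_sqrt hab)] at hu
      have hu0 : 0 < u := (Real.sqrt_pos.2 ha).trans_le hu.1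
      have hpow : (u ^ 2) ^ (-(1 / 2) : ℝ) = u⁻¹ := by
        rw [← Real.rpow_natCast, ← Real.rpow_mul hu0.le]
        norm_num
        exact Real.rpow_neg_one u
      have huC : (u : ℂ) ≠ 0 := Complex.ofReal_ne_zero.2 hu0.ne'
      have hq : x * u ^ 2 + t * (u ^ 2) ^ 2 = quarticPhase x t u := by
        simp only [quarticPhase]; ring
      simp only [Function.comp, Complex.real_smul]
      rw [hpow, hq]
      push_cast
      field_simp
    rw [hEq, norm_mul, Complex.norm_ofNat]
    have := norm_integral_quarticPhase_le (t := t) hx (Real.sqrt_nonneg a) (Real.sqrt_nonneg b)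
    have h48 : 48 / √|x| = 2 * (24 / √|x|) := by ring
    linarith
  · intro ξ hξ
    obtain ⟨u, hu, rfl⟩ := hξ
    rw [uIcc_of_le (Real.sqrt_le_sqrt hab)] at hu
    have hu0 : 0 < u := (Real.sqrt_pos.2 ha).trans_le hu.1
    have : (u ^ 2 : ℝ) ≠ 0 := by positivity
    refine ContinuousAt.continuousWithinAt (ContinuousAt.mul (by fun_prop) ?_)
    exact Complex.continuous_ofReal.continuousAt.comp
      (Real.continuousAt_rpow_const _ _ (Or.inl this))

lemma lintegral_comp_abs_le (G : ℝ → ℝ≥0∞) : ∫⁻ z, G |z| ≤ 2 * ∫⁻ z in Ioi 0, G z := by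
  have h1 : ∫⁻ z in Ioi 0, G |z| = ∫⁻ z in Ioi 0, G z :=
    setLIntegral_congr_fun measurableSet_Ioi fun z hz => by rw [abs_of_pos hz]
  have h2 : ∫⁻ z in Iic 0, G |z| = ∫⁻ z in Ioi 0, G z := by
    rw [← h1, setLIntegral_congr (Iio_ae_eq_Iic (a := (0 : ℝ))).symm,
      ← lintegral_indicator measurableSet_Iio, ← lintegral_indicator measurableSet_Ioi,
      ← lintegral_neg_eq_self]
    refine lintegral_congr fun z => ?_
    simp only [indicator, mem_Iio, mem_Ioi, abs_neg, Left.neg_neg_iff]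
  rw [← lintegral_add_compl _ (measurableSet_Ioi (a := (0 : ℝ))), compl_Ioi, h1, h2, two_mul]

lemma lintegral_inv_sqrt_abs_le {r : ℝ} (hr : 0 < r) :
    ∫⁻ z, (Iic r).indicator (fun s => ENNReal.ofReal (1 / √s)) |z| ≤ ENNReal.ofReal (4 * √r) := by
  refine (lintegral_comp_abs_le _).trans ?_
  rw [setLIntegral_indicator measurableSet_Iic, inter_comm, Ioi_inter_Iic]
  have hEq : ∀ s ∈ Ioc 0 r, 1 / √s = s ^ (-(1 / 2) : ℝ) := fun s hs => by
    rw [Real.rpow_neg hs.1.le, Real.sqrt_eq_rpow, one_div]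
  have hint : IntegrableOn (fun s : ℝ => s ^ (-(1 / 2) : ℝ)) (Ioc 0 r) := by
    rw [← intervalIntegrable_iff_integrableOn_Ioc_of_le hr.le]
    exact intervalIntegral.intervalIntegrable_rpow' (by norm_num)
  rw [setLIntegral_congr_fun measurableSet_Ioc fun s hs => by rw [hEq s hs],
    ← ofReal_integral_eq_lintegral_ofReal hint, ← intervalIntegral.integral_of_le hr.le,
    integral_rpow (Or.inl (by norm_num))]
  · rw [show (2 : ℝ≥0∞) = ENNReal.ofReal 2 by simp, ← ENNReal.ofReal_mul (by norm_num)]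
    apply ENNReal.ofReal_le_ofReal
    rw [Real.sqrt_eq_rpow, Real.zero_rpow (by norm_num)]
    norm_num
    linarith
  · exact (ae_restrict_iff' measurableSet_Ioc).2 (ae_of_all _ fun s hs => Real.rpow_nonneg hs.1.le _)

lemma lintegral_inv_sq_abs_le {r : ℝ} (hr : 0 < r) :
    ∫⁻ z, (Ioi r).indicator (fun s => ENNReal.ofReal (1 / s ^ 2)) |z| ≤ ENNReal.ofReal (2 / r) := by
  refine (lintegral_comp_abs_le _).trans ?_
  rw [setLIntegral_indicator measurableSet_Ioi,
    inter_eq_left.2 (Ioi_subset_Ioi hr.le)]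
  have hEq : ∀ s ∈ Ioi r, 1 / s ^ 2 = s ^ (-2 : ℝ) := fun s hs => by
    rw [Real.rpow_neg (hr.trans hs).le, one_div]; norm_cast
  rw [setLIntegral_congr_fun measurableSet_Ioi fun s hs => by rw [hEq s hs],
    ← ofReal_integral_eq_lintegral_ofReal (integrableOn_Ioi_rpow_of_lt (by norm_num) hr),
    integral_Ioi_rpow_of_lt (by norm_num) hr]
  · rw [show (2 : ℝ≥0∞) = ENNReal.ofReal 2 by simp, ← ENNReal.ofReal_mul (by norm_num)]
    apply ENNReal.ofReal_le_ofReal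
    norm_num
    rw [Real.rpow_neg_one, div_eq_mul_inv]
  · exact (ae_restrict_iff' measurableSet_Ioi).2
      (ae_of_all _ fun s hs => Real.rpow_nonneg (hr.trans hs).le _)

lemma cube_mul_inv_sqrt_le {p s l : ℝ} (hp : 0 ≤ p) (hl : 0 < l) (hs : 0 < s) :
    p ^ 3 * (1 / √s) ≤ l * p ^ 4 + (l⁻¹) ^ 3 * (1 / s ^ 2) := by
  have hs' := Real.sqrt_pos.2 hs
  set q := 1 / √s with hq
  have hq0 : 0 < q := by positivity
  have hq4 : 1 / s ^ 2 = q ^ 4 := by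
    rw [hq, div_pow, one_pow, show √s ^ 4 = (√s ^ 2) ^ 2 by ring, Real.sq_sqrt hs.le]
  rw [hq4]
  rcases le_total q (l * p) with h | h
  · have h1 : p ^ 3 * q ≤ p ^ 3 * (l * p) := mul_le_mul_of_nonneg_left h (by positivity)
    have h2 : 0 ≤ (l⁻¹) ^ 3 * q ^ 4 := by positivity
    nlinarith
  · have h0 : p ≤ l⁻¹ * q := by rwa [← div_eq_inv_mul, le_div_iff₀ hl, mul_comm]
    have h1 : p ^ 3 * q ≤ (l⁻¹ * q) ^ 3 * q :=
      mul_le_mul_of_nonneg_right (pow_le_pow_left₀ hp h0 3) hq0.le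
    have h2 : 0 ≤ l * p ^ 4 := by positivity
    have h3 : (l⁻¹ * q) ^ 3 * q = (l⁻¹) ^ 3 * q ^ 4 := by ring
    linarith

lemma lintegral_fractional_le {h : ℝ → ℝ} (hm : Measurable h) (h0 : ∀ x, 0 ≤ h x)
    {A : ℝ} (hA : 0 < A) (hhA : ∫⁻ x, ENNReal.ofReal (h x ^ 4) ≤ ENNReal.ofReal A)
    (x : ℝ) {v : ℝ} (hv : 0 ≤ v) :
    ∫⁻ y, {y | h y ≤ v}.indicator (fun y => ENNReal.ofReal (h y ^ 3 * (1 / √|x - y|))) y ≤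
      ENNReal.ofReal (7 * √A * v) := by
  rcases hv.eq_or_lt with rfl | hv
  · rw [lintegral_eq_zero_of_ae_eq_zero]
    · simp
    · refine ae_of_all _ fun y => ?_
      by_cases hy : h y ≤ 0
      · have : h y = 0 := le_antisymm hy (h0 y)
        simp [indicator, this]
      · simp [indicator, hy]
  have hsA := Real.sqrt_pos.2 hA
  have hAA : √A ^ 2 = A := Real.sq_sqrt hA.le
  set r := A / v ^ 4 with hr
  set l := v / √A with hl
  have hr0 : 0 < r := by positivity
  have hl0 : 0 < l := by positivity
  have hsr : √r = √A / v ^ 2 := by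
    rw [hr, Real.sqrt_div hA.le, show v ^ 4 = (v ^ 2) ^ 2 by ring, Real.sqrt_sq (by positivity)]
  set G1 : ℝ → ℝ≥0∞ := (Iic r).indicator fun s => ENNReal.ofReal (1 / √s) with hG1
  set G2 : ℝ → ℝ≥0∞ := (Ioi r).indicator fun s => ENNReal.ofReal (1 / s ^ 2) with hG2
  have mG1 : Measurable G1 := Measurable.indicator (by fun_prop) measurableSet_Iic
  have mG2 : Measurable G2 := Measurable.indicator (by fun_prop) measurableSet_Ioi
  have hpt : ∀ y, {y | h y ≤ v}.indicator
      (fun y => ENNReal.ofReal (h y ^ 3 * (1 / √|x - y|))) y ≤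
      ENNReal.ofReal (v ^ 3) * G1 |x - y| + (ENNReal.ofReal l * ENNReal.ofReal (h y ^ 4) +
        ENNReal.ofReal ((l⁻¹) ^ 3) * G2 |x - y|) := by
    intro y
    by_cases hy : h y ≤ v
    · rw [indicator_of_mem (by exact hy)]
      by_cases hs : |x - y| ≤ r
      · rw [hG1, indicator_of_mem (by exact hs), ← ENNReal.ofReal_mul (by positivity)]
        refine le_trans (ENNReal.ofReal_le_ofReal ?_) le_self_add
        exact mul_le_mul_of_nonneg_right (pow_le_pow_left₀ (h0 y) hy 3) (by positivity)
      · push Not at hs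
        rw [hG2, indicator_of_mem (by exact hs), ← ENNReal.ofReal_mul (by positivity),
          ← ENNReal.ofReal_mul (by positivity),
          ← ENNReal.ofReal_add (mul_nonneg hl0.le (pow_nonneg (h0 y) 4)) (by positivity)]
        exact le_trans (ENNReal.ofReal_le_ofReal
          (cube_mul_inv_sqrt_le (h0 y) hl0 (hr0.trans hs))) le_add_self
    · rw [indicator_of_notMem (by exact hy)]
      exact zero_le
  have t1 : ∫⁻ y, G1 |x - y| ≤ ENNReal.ofReal (4 * √r) := by
    rw [lintegral_sub_left_eq_self (fun z => G1 |z|) x]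
    exact lintegral_inv_sqrt_abs_le hr0
  have t2 : ∫⁻ y, G2 |x - y| ≤ ENNReal.ofReal (2 / r) := by
    rw [lintegral_sub_left_eq_self (fun z => G2 |z|) x]
    exact lintegral_inv_sq_abs_le hr0
  refine (lintegral_mono hpt).trans ?_
  rw [lintegral_add_left (by fun_prop), lintegral_add_left (by fun_prop),
    lintegral_const_mul _ (by fun_prop), lintegral_const_mul _ (by fun_prop),
    lintegral_const_mul _ (by fun_prop)]
  calc _ ≤ ENNReal.ofReal (v ^ 3) * ENNReal.ofReal (4 * √r) +
        (ENNReal.ofReal l * ENNReal.ofReal A +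
        ENNReal.ofReal ((l⁻¹) ^ 3) * ENNReal.ofReal (2 / r)) := by gcongr
    _ = ENNReal.ofReal (7 * √A * v) := by
        rw [← ENNReal.ofReal_mul (by positivity), ← ENNReal.ofReal_mul (by positivity),
          ← ENNReal.ofReal_mul (by positivity), ← ENNReal.ofReal_add (by positivity) (by positivity),
          ← ENNReal.ofReal_add (by positivity) (by positivity)]
        congr 1
        rw [hsr, hl, hr, ← hAA, Real.sqrt_sq hsA.le]
        field_simp
        ring

/-- The diagonal Hardy–Littlewood–Sobolev inequality with kernel `|x - y|^{-1/2}`, for `h ^ 3`. -/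
lemma lintegral_hardyLittlewoodSobolev_le {h : ℝ → ℝ} (hm : Measurable h) (h0 : ∀ x, 0 ≤ h x)
    {A : ℝ} (hA : 0 < A) (hhA : ∫⁻ x, ENNReal.ofReal (h x ^ 4) ≤ ENNReal.ofReal A) :
    ∫⁻ x, ∫⁻ y, ENNReal.ofReal (h x ^ 3 * h y ^ 3 * (1 / √|x - y|)) ≤
      ENNReal.ofReal (14 * (A * √A)) := by
  set Φ : ℝ → ℝ → ℝ≥0∞ := fun x y => ENNReal.ofReal (h x ^ 3 * h y ^ 3 * (1 / √|x - y|)) with hΦ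
  set Ψ : ℝ → ℝ → ℝ≥0∞ := fun x y =>
    {q : ℝ × ℝ | h q.2 ≤ h q.1}.indicator (fun q => Φ q.1 q.2) (x, y) with hΨ
  have mS : MeasurableSet {q : ℝ × ℝ | h q.2 ≤ h q.1} :=
    measurableSet_le (by fun_prop) (by fun_prop)
  have mΨ : Measurable (Function.uncurry Ψ) := by
    have : Function.uncurry Ψ =
        {q : ℝ × ℝ | h q.2 ≤ h q.1}.indicator (fun q => Φ q.1 q.2) := by ext ⟨x, y⟩; rfl
    rw [this]
    exact Measurable.indicator (by simp only [hΦ]; fun_prop) mS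
  have hle : ∀ x y, Φ x y ≤ Ψ x y + Ψ y x := by
    intro x y
    rcases le_total (h y) (h x) with hxy | hxy
    · have : Ψ x y = Φ x y := indicator_of_mem (by exact hxy) _
      rw [this]; exact le_self_add
    · have : Ψ y x = Φ y x := indicator_of_mem (by exact hxy) _
      have h2 : Φ y x = Φ x y := by
        simp only [hΦ]; rw [abs_sub_comm, mul_comm (h y ^ 3)]
      rw [this, h2]; exact le_add_self
  have hΨint : ∫⁻ x, ∫⁻ y, Ψ x y ≤ ENNReal.ofReal (7 * (A * √A)) := by
    calc ∫⁻ x, ∫⁻ y, Ψ x y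
        ≤ ∫⁻ x, ENNReal.ofReal (7 * √A) * ENNReal.ofReal (h x ^ 4) := by
          refine lintegral_mono fun x => ?_
          have hx := lintegral_fractional_le hm h0 hA hhA x (h0 x)
          calc ∫⁻ y, Ψ x y = ∫⁻ y, ENNReal.ofReal (h x ^ 3) * {y | h y ≤ h x}.indicator
                (fun y => ENNReal.ofReal (h y ^ 3 * (1 / √|x - y|))) y := by
                refine lintegral_congr fun y => ?_
                by_cases hy : h y ≤ h x
                · simp only [hΨ, hΦ, indicator, mem_ofPred_eq, hy, if_true]
                  rw [← ENNReal.ofReal_mul (pow_nonneg (h0 x) 3), mul_assoc]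
                · simp [hΨ, indicator, hy]
            _ = ENNReal.ofReal (h x ^ 3) * ∫⁻ y, {y | h y ≤ h x}.indicator
                (fun y => ENNReal.ofReal (h y ^ 3 * (1 / √|x - y|))) y := by
                refine lintegral_const_mul _ (Measurable.indicator (by fun_prop) ?_)
                exact measurableSet_le hm measurable_const
            _ ≤ ENNReal.ofReal (h x ^ 3) * ENNReal.ofReal (7 * √A * h x) := by gcongr
            _ = _ := by
                rw [← ENNReal.ofReal_mul (pow_nonneg (h0 x) 3), ← ENNReal.ofReal_mul (by positivity)]
                congr 1; ring
      _ = ENNReal.ofReal (7 * √A) * ∫⁻ x, ENNReal.ofReal (h x ^ 4) :=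
          lintegral_const_mul _ (by fun_prop)
      _ ≤ ENNReal.ofReal (7 * √A) * ENNReal.ofReal A := by gcongr
      _ = _ := by rw [← ENNReal.ofReal_mul (by positivity)]; congr 1; ring
  calc ∫⁻ x, ∫⁻ y, Φ x y ≤ ∫⁻ x, ∫⁻ y, (Ψ x y + Ψ y x) :=
        lintegral_mono fun x => lintegral_mono fun y => hle x y
    _ = (∫⁻ x, ∫⁻ y, Ψ x y) + ∫⁻ x, ∫⁻ y, Ψ y x := by
        have mI : Measurable fun x => ∫⁻ y, Ψ x y := mΨ.lintegral_prod_right'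
        rw [← lintegral_add_left mI]
        exact lintegral_congr fun x => lintegral_add_left (mΨ.comp measurable_prodMk_left) _
    _ = (∫⁻ x, ∫⁻ y, Ψ x y) + ∫⁻ x, ∫⁻ y, Ψ x y := by
        congr 1
        exact lintegral_lintegral_swap (mΨ.comp measurable_swap).aemeasurable
    _ ≤ ENNReal.ofReal (7 * (A * √A)) + ENNReal.ofReal (7 * (A * √A)) := by gcongr
    _ = _ := by rw [← ENNReal.ofReal_add (by positivity) (by positivity)]; congr 1; ring

lemma enorm_setIntegral_kernel_le {x t a b : ℝ} (hx : x ≠ 0) (ha : 0 < a) (hab : a ≤ b) :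
    ‖∫ ξ in Ioc a b, Complex.exp ((2 * π * x * ξ + t * ξ ^ 2 : ℝ) * Complex.I) *
      ((ξ ^ (-(1 / 2) : ℝ) : ℝ) : ℂ)‖ₑ ≤ ENNReal.ofReal (48 * (1 / √|x|)) := by
  rw [← ofReal_norm]
  apply ENNReal.ofReal_le_ofReal
  refine (norm_setIntegral_kernel_le (by positivity) ha hab).trans ?_
  rw [mul_one_div]
  have hx' := abs_pos.2 hx
  refine div_le_div_of_nonneg_left (by norm_num) (Real.sqrt_pos.2 hx') (Real.sqrt_le_sqrt ?_)
  rw [abs_mul, abs_of_pos (by positivity : 0 < 2 * π)]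
  nlinarith [Real.pi_gt_three]

lemma mul_conj_oscillation (F : ℝ → ℂ) (τ : ℝ → ℝ) (x y ξ : ℝ) :
    (F x * Complex.exp ((2 * π * x * ξ + τ x * ξ ^ 2 : ℝ) * Complex.I)) *
      (starRingEnd ℂ) (F y * Complex.exp ((2 * π * y * ξ + τ y * ξ ^ 2 : ℝ) * Complex.I)) =
    (F x * (starRingEnd ℂ) (F y)) *
      Complex.exp ((2 * π * (x - y) * ξ + (τ x - τ y) * ξ ^ 2 : ℝ) * Complex.I) := by
  have : Complex.exp ((2 * π * (x - y) * ξ + (τ x - τ y) * ξ ^ 2 : ℝ) * Complex.I) =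
      Complex.exp ((2 * π * x * ξ + τ x * ξ ^ 2 : ℝ) * Complex.I) *
      (starRingEnd ℂ) (Complex.exp ((2 * π * y * ξ + τ y * ξ ^ 2 : ℝ) * Complex.I)) := by
    rw [← Complex.exp_conj, ← Complex.exp_add, map_mul, Complex.conj_ofReal, Complex.conj_I]
    congr 1
    push_cast
    ring
  rw [this, map_mul]
  ring

lemma integrableOn_rpow_neg_half {a b : ℝ} (ha : 0 < a) :
    IntegrableOn (fun ξ : ℝ => ((ξ ^ (-(1 / 2) : ℝ) : ℝ) : ℂ)) (Ioc a b) := by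
  apply Integrable.ofReal
  refine (ContinuousOn.integrableOn_Icc fun ξ hξ => ?_).mono_set Ioc_subset_Icc_self
  exact (Real.continuousAt_rpow_const _ _ (Or.inl (ha.trans_le hξ.1).ne')).continuousWithinAt

lemma lintegral_Ioc_dual_le {F : ℝ → ℂ} {τ h : ℝ → ℝ} (hF : Integrable F) (hτ : Measurable τ)
    (hm : Measurable h) (h0 : ∀ x, 0 ≤ h x) (hFh : ∀ x, ‖F x‖ = h x ^ 3)
    {A : ℝ} (hA : 0 < A) (hhA : ∫⁻ x, ENNReal.ofReal (h x ^ 4) ≤ ENNReal.ofReal A)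
    {a b : ℝ} (ha : 0 < a) (hab : a ≤ b) :
    ∫⁻ ξ in Ioc a b, ENNReal.ofReal (ξ ^ (-(1 / 2) : ℝ) *
      ‖∫ x, F x * Complex.exp ((2 * π * x * ξ + τ x * ξ ^ 2 : ℝ) * Complex.I)‖ ^ 2) ≤
      ENNReal.ofReal (672 * (A * √A)) := by
  set e : ℝ → ℝ → ℂ := fun ξ x => F x * Complex.exp ((2 * π * x * ξ + τ x * ξ ^ 2 : ℝ) * Complex.I)
    with he
  set Q : ℝ → ℝ × ℝ → ℂ := fun ξ p => ((ξ ^ (-(1 / 2) : ℝ) : ℝ) : ℂ) *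
    (e ξ p.1 * (starRingEnd ℂ) (e ξ p.2)) with hQ
  have hQ' : ∀ ξ p, Q ξ p = Complex.exp ((2 * π * (p.1 - p.2) * ξ + (τ p.1 - τ p.2) * ξ ^ 2 : ℝ) *
      Complex.I) * (((ξ ^ (-(1 / 2) : ℝ) : ℝ) : ℂ) * (F p.1 * (starRingEnd ℂ) (F p.2))) := by
    intro ξ p
    simp only [hQ, he]
    rw [mul_conj_oscillation]
    ring
  have hFc : Integrable fun x => (starRingEnd ℂ) (F x) :=
    (Complex.conjLIE.toContinuousLinearEquiv : ℂ →L[ℝ] ℂ).integrable_comp hF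
  have hFF : Integrable (fun p : ℝ × ℝ => F p.1 * (starRingEnd ℂ) (F p.2))
      (volume.prod volume) := hF.mul_prod hFc
  have hbase : Integrable (fun q : ℝ × (ℝ × ℝ) => ((q.1 ^ (-(1 / 2) : ℝ) : ℝ) : ℂ) *
      (F q.2.1 * (starRingEnd ℂ) (F q.2.2)))
      ((volume.restrict (Ioc a b)).prod (volume.prod volume)) :=
    Integrable.mul_prod (integrableOn_rpow_neg_half ha) hFF
  have hQint : Integrable (Function.uncurry Q)
      ((volume.restrict (Ioc a b)).prod (volume.prod volume)) := by
    have hcong : Function.uncurry Q = fun q : ℝ × (ℝ × ℝ) =>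
        Complex.exp ((2 * π * (q.2.1 - q.2.2) * q.1 + (τ q.2.1 - τ q.2.2) * q.1 ^ 2 : ℝ) *
        Complex.I) * (((q.1 ^ (-(1 / 2) : ℝ) : ℝ) : ℂ) *
          (F q.2.1 * (starRingEnd ℂ) (F q.2.2))) := by
      ext ⟨ξ, p⟩; exact hQ' ξ p
    rw [hcong]
    refine hbase.bdd_mul (c := 1) (Measurable.aestronglyMeasurable (by fun_prop))
      (ae_of_all _ fun q => ?_)
    rw [Complex.norm_exp_ofReal_mul_I]
  have hsq : ∀ ξ, ((ξ ^ (-(1 / 2) : ℝ) * ‖∫ x, e ξ x‖ ^ 2 : ℝ) : ℂ) = ∫ p, Q ξ p := by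
    intro ξ
    have h1 : ∫ p : ℝ × ℝ, e ξ p.1 * (starRingEnd ℂ) (e ξ p.2) =
        (∫ x, e ξ x) * ∫ y, (starRingEnd ℂ) (e ξ y) :=
      integral_prod_mul (μ := volume) (ν := volume) (e ξ) fun y => (starRingEnd ℂ) (e ξ y)
    simp only [hQ]
    rw [integral_const_mul, h1, integral_conj, Complex.mul_conj, Complex.normSq_eq_norm_sq]
    push_cast
    rfl
  have hnn : ∀ ξ ∈ Ioc a b, 0 ≤ ξ ^ (-(1 / 2) : ℝ) * ‖∫ x, e ξ x‖ ^ 2 := fun ξ hξ =>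
    mul_nonneg (Real.rpow_nonneg (ha.trans hξ.1).le _) (by positivity)
  have hint : Integrable (fun ξ => ((ξ ^ (-(1 / 2) : ℝ) * ‖∫ x, e ξ x‖ ^ 2 : ℝ) : ℂ))
      (volume.restrict (Ioc a b)) := by
    simp only [hsq]; exact hQint.integral_prod_left
  have hintR : Integrable (fun ξ => ξ ^ (-(1 / 2) : ℝ) * ‖∫ x, e ξ x‖ ^ 2)
      (volume.restrict (Ioc a b)) := by
    exact hint.re
  have hae : 0 ≤ᵐ[volume.restrict (Ioc a b)] fun ξ => ξ ^ (-(1 / 2) : ℝ) * ‖∫ x, e ξ x‖ ^ 2 :=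
    (ae_restrict_iff' measurableSet_Ioc).2 (ae_of_all _ hnn)
  rw [← ofReal_integral_eq_lintegral_ofReal hintR hae]
  have hnorm : ENNReal.ofReal (∫ ξ in Ioc a b, ξ ^ (-(1 / 2) : ℝ) * ‖∫ x, e ξ x‖ ^ 2) =
      ‖∫ p : ℝ × ℝ, ∫ ξ in Ioc a b, Q ξ p‖ₑ := by
    rw [← Measure.volume_eq_prod] at hQint
    rw [← integral_integral_swap hQint, ← integral_congr_ae (ae_of_all _ hsq),
      integral_complex_ofReal, ← ofReal_norm, Complex.norm_real,
      Real.norm_of_nonneg (integral_nonneg_of_ae hae)]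
  rw [hnorm]
  have hker : ∀ p : ℝ × ℝ, ∫ ξ in Ioc a b, Q ξ p = (F p.1 * (starRingEnd ℂ) (F p.2)) *
      ∫ ξ in Ioc a b, Complex.exp ((2 * π * (p.1 - p.2) * ξ + (τ p.1 - τ p.2) * ξ ^ 2 : ℝ) *
      Complex.I) * ((ξ ^ (-(1 / 2) : ℝ) : ℝ) : ℂ) := by
    intro p
    rw [← integral_const_mul]
    refine integral_congr_ae (ae_of_all _ fun ξ => ?_)
    change Q ξ p = _
    rw [hQ']; ring
  calc ‖∫ p : ℝ × ℝ, ∫ ξ in Ioc a b, Q ξ p‖ₑ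
      ≤ ∫⁻ p : ℝ × ℝ, ‖∫ ξ in Ioc a b, Q ξ p‖ₑ := enorm_integral_le_lintegral_enorm _
    _ ≤ ∫⁻ p : ℝ × ℝ, ENNReal.ofReal 48 *
          ENNReal.ofReal (h p.1 ^ 3 * h p.2 ^ 3 * (1 / √|p.1 - p.2|)) := by
        have hne : ∀ᵐ p : ℝ × ℝ, p.1 ≠ p.2 := by
          rw [Measure.volume_eq_prod, Measure.ae_prod_iff_ae_ae]
          · refine ae_of_all _ fun x => ?_
            filter_upwards [compl_mem_ae_iff.2 (measure_singleton x)] with y hy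
            exact fun hxy => hy hxy.symm
          · exact (measurableSet_eq_fun measurable_fst measurable_snd).compl
        refine lintegral_mono_ae (hne.mono fun p hp => ?_)
        rw [hker, enorm_mul]
        have h1 : ‖F p.1 * (starRingEnd ℂ) (F p.2)‖ₑ = ENNReal.ofReal (h p.1 ^ 3 * h p.2 ^ 3) := by
          rw [← ofReal_norm, norm_mul, RCLike.norm_conj, hFh, hFh]
        have hnn3 : 0 ≤ h p.1 ^ 3 * h p.2 ^ 3 :=
          mul_nonneg (pow_nonneg (h0 _) 3) (pow_nonneg (h0 _) 3)
        rw [h1]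
        refine (mul_le_mul_right (enorm_setIntegral_kernel_le (sub_ne_zero.2 hp) ha hab) _).trans ?_
        rw [← ENNReal.ofReal_mul hnn3, ← ENNReal.ofReal_mul (by norm_num)]
        apply le_of_eq; congr 1; ring
    _ = ENNReal.ofReal 48 * ∫⁻ x, ∫⁻ y,
          ENNReal.ofReal (h x ^ 3 * h y ^ 3 * (1 / √|x - y|)) := by
        rw [lintegral_const_mul _ (by fun_prop), Measure.volume_eq_prod,
          lintegral_prod _ (Measurable.aemeasurable (by fun_prop))]
    _ ≤ ENNReal.ofReal 48 * ENNReal.ofReal (14 * (A * √A)) := by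
        gcongr; exact lintegral_hardyLittlewoodSobolev_le hm h0 hA hhA
    _ = _ := by rw [← ENNReal.ofReal_mul (by norm_num)]; congr 1; ring

lemma measurable_oscillatory_integral {F : ℝ → ℂ} {θ : ℝ → ℝ → ℝ} (hF : Measurable F)
    (hθ : Measurable (Function.uncurry θ)) :
    Measurable fun ξ => ∫ x, F x * Complex.exp (θ ξ x * Complex.I) := by
  have : Measurable (Function.uncurry fun ξ x => F x * Complex.exp (θ ξ x * Complex.I)) := by
    have h1 : Measurable fun q : ℝ × ℝ => θ q.1 q.2 := hθ
    simp only [Function.uncurry_def]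
    fun_prop
  exact this.stronglyMeasurable.integral_prod_right.measurable

lemma lintegral_Ioi_dual_le {F : ℝ → ℂ} {τ h : ℝ → ℝ} (hFm : Measurable F) (hF : Integrable F)
    (hτ : Measurable τ)
    (hm : Measurable h) (h0 : ∀ x, 0 ≤ h x) (hFh : ∀ x, ‖F x‖ = h x ^ 3)
    {A : ℝ} (hA : 0 < A) (hhA : ∫⁻ x, ENNReal.ofReal (h x ^ 4) ≤ ENNReal.ofReal A) :
    ∫⁻ ξ in Ioi 0, ENNReal.ofReal (ξ ^ (-(1 / 2) : ℝ) *
      ‖∫ x, F x * Complex.exp ((2 * π * x * ξ + τ x * ξ ^ 2 : ℝ) * Complex.I)‖ ^ 2) ≤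
      ENNReal.ofReal (672 * (A * √A)) := by
  have hmeas := measurable_oscillatory_integral (F := F)
    (θ := fun ξ x => 2 * π * x * ξ + τ x * ξ ^ 2) hFm (by fun_prop)
  have hU : (⋃ n : ℕ, Ioc ((1 : ℝ) / (n + 1)) (n + 1)) = Ioi 0 := by
    ext ξ
    simp only [mem_iUnion, mem_Ioc, mem_Ioi]
    constructor
    · rintro ⟨n, h1, -⟩
      exact lt_trans (by positivity) h1
    · intro hξ
      obtain ⟨n, hn⟩ := exists_nat_one_div_lt hξ
      obtain ⟨k, hk⟩ := exists_nat_ge ξ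
      refine ⟨max n k, lt_of_le_of_lt ?_ hn, ?_⟩
      · apply one_div_le_one_div_of_le (by positivity)
        have : (n : ℝ) ≤ (max n k : ℕ) := by exact_mod_cast le_max_left n k
        linarith
      · have : (k : ℝ) ≤ (max n k : ℕ) := by exact_mod_cast le_max_right n k
        linarith
  have hmono : Monotone fun n : ℕ => Ioc ((1 : ℝ) / (n + 1)) (n + 1) := by
    intro n k hnk
    have : (n : ℝ) ≤ k := by exact_mod_cast hnk
    exact Ioc_subset_Ioc (one_div_le_one_div_of_le (by positivity) (by linarith)) (by linarith)
  rw [← hU, setLIntegral_iUnion_of_directed _ hmono.directed_le]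
  refine iSup_le fun n => ?_
  refine lintegral_Ioc_dual_le hF hτ hm h0 hFh hA hhA (by positivity) ?_
  rw [div_le_iff₀ (by positivity)]
  have : (0 : ℝ) ≤ n := by positivity
  nlinarith

lemma lintegral_dual_le {F : ℝ → ℂ} {τ h : ℝ → ℝ} (hFm : Measurable F) (hF : Integrable F)
    (hτ : Measurable τ)
    (hm : Measurable h) (h0 : ∀ x, 0 ≤ h x) (hFh : ∀ x, ‖F x‖ = h x ^ 3)
    {A : ℝ} (hA : 0 < A) (hhA : ∫⁻ x, ENNReal.ofReal (h x ^ 4) ≤ ENNReal.ofReal A) :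
    ∫⁻ ξ, ENNReal.ofReal (|ξ| ^ (-(1 / 2) : ℝ) *
      ‖∫ x, F x * Complex.exp ((2 * π * x * ξ + τ x * (ξ * |ξ|) : ℝ) * Complex.I)‖ ^ 2) ≤
      ENNReal.ofReal (1344 * (A * √A)) := by
  have hpos := lintegral_Ioi_dual_le hFm hF hτ hm h0 hFh hA hhA
  have hFc : Integrable fun x => (starRingEnd ℂ) (F x) :=
    (Complex.conjLIE.toContinuousLinearEquiv : ℂ →L[ℝ] ℂ).integrable_comp hF
  have hneg := lintegral_Ioi_dual_le (F := fun x => (starRingEnd ℂ) (F x))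
    (Complex.continuous_conj.measurable.comp hFm) hFc hτ hm h0
    (fun x => by rw [RCLike.norm_conj, hFh]) hA hhA
  rw [← lintegral_add_compl _ (measurableSet_Ioi (a := (0 : ℝ))), compl_Ioi]
  have h1344 : ENNReal.ofReal (1344 * (A * √A)) =
      ENNReal.ofReal (672 * (A * √A)) + ENNReal.ofReal (672 * (A * √A)) := by
    rw [← ENNReal.ofReal_add (by positivity) (by positivity)]; congr 1; ring
  rw [h1344]
  refine add_le_add (le_trans (le_of_eq ?_) hpos) (le_trans (le_of_eq ?_) hneg)
  · refine setLIntegral_congr_fun measurableSet_Ioi fun ξ hξ => ?_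
    simp only [abs_of_pos (mem_Ioi.1 hξ), sq]
  · rw [setLIntegral_congr (Iio_ae_eq_Iic (a := (0 : ℝ))).symm,
      ← lintegral_indicator measurableSet_Iio, ← lintegral_indicator measurableSet_Ioi,
      ← lintegral_neg_eq_self]
    refine lintegral_congr fun ξ => ?_
    simp only [indicator, mem_Iio, mem_Ioi, Left.neg_neg_iff]
    split_ifs with hξ
    · rw [abs_neg, abs_of_pos hξ, ← RCLike.norm_conj (∫ x, F x * _), ← integral_conj]
      congr 5
      ext x
      rw [map_mul, ← Complex.exp_conj, map_mul, Complex.conj_ofReal, Complex.conj_I]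
      congr 2
      push_cast
      ring
    · rfl

/-- The evolution `D_x^{-1/4} V(t)` applied to a function with Fourier transform `g`, evaluated
at `x`. -/
def smoothedEvolution (g : ℝ → ℂ) (x t : ℝ) : ℂ :=
  ∫ ξ, Complex.exp ((2 * π * x * ξ + t * (ξ * |ξ|) : ℝ) * Complex.I) *
    (((|ξ| ^ (-(1 / 4) : ℝ) : ℝ) : ℂ) * g ξ)

lemma continuous_smoothedEvolution {g : ℝ → ℂ}
    (hw : Integrable fun ξ => ((|ξ| ^ (-(1 / 4) : ℝ) : ℝ) : ℂ) * g ξ) :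
    Continuous fun p : ℝ × ℝ => smoothedEvolution g p.1 p.2 := by
  refine continuous_of_dominated (bound := fun ξ => ‖((|ξ| ^ (-(1 / 4) : ℝ) : ℝ) : ℂ) * g ξ‖)
    (fun p => ?_) (fun p => ae_of_all _ fun ξ => ?_) hw.norm (ae_of_all _ fun ξ => ?_)
  · exact (Continuous.aestronglyMeasurable (by fun_prop)).mul hw.aestronglyMeasurable
  · rw [norm_mul, Complex.norm_exp_ofReal_mul_I, one_mul]
  · fun_prop

lemma norm_smoothedEvolution_le (g : ℝ → ℂ) (x t : ℝ) :
    ‖smoothedEvolution g x t‖ ≤ ∫ ξ, ‖((|ξ| ^ (-(1 / 4) : ℝ) : ℝ) : ℂ) * g ξ‖ := by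
  refine (norm_integral_le_integral_norm _).trans (le_of_eq (integral_congr_ae (ae_of_all _ ?_)))
  intro ξ
  simp only
  rw [norm_mul, Complex.norm_exp_ofReal_mul_I, one_mul]

lemma integral_mul_smoothedEvolution {g F : ℝ → ℂ} {τ : ℝ → ℝ}
    (hw : Integrable fun ξ => ((|ξ| ^ (-(1 / 4) : ℝ) : ℝ) : ℂ) * g ξ) (hF : Integrable F)
    (hτ : Measurable τ) :
    ∫ x, F x * smoothedEvolution g x (τ x) =
      ∫ ξ, (((|ξ| ^ (-(1 / 4) : ℝ) : ℝ) : ℂ) * g ξ) *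
        ∫ x, F x * Complex.exp ((2 * π * x * ξ + τ x * (ξ * |ξ|) : ℝ) * Complex.I) := by
  have hint : Integrable (Function.uncurry fun x ξ : ℝ =>
      Complex.exp ((2 * π * x * ξ + τ x * (ξ * |ξ|) : ℝ) * Complex.I) *
        (F x * (((|ξ| ^ (-(1 / 4) : ℝ) : ℝ) : ℂ) * g ξ))) (volume.prod volume) := by
    refine (hF.mul_prod hw).bdd_mul (c := 1) (Measurable.aestronglyMeasurable (by fun_prop))
      (ae_of_all _ fun q => ?_)
    rw [Complex.norm_exp_ofReal_mul_I]
  calc ∫ x, F x * smoothedEvolution g x (τ x)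
      = ∫ x, ∫ ξ, Complex.exp ((2 * π * x * ξ + τ x * (ξ * |ξ|) : ℝ) * Complex.I) *
          (F x * (((|ξ| ^ (-(1 / 4) : ℝ) : ℝ) : ℂ) * g ξ)) := by
        refine integral_congr_ae (ae_of_all _ fun x => ?_)
        simp only [smoothedEvolution]
        rw [← integral_const_mul]
        refine integral_congr_ae (ae_of_all _ fun ξ => ?_)
        simp only
        ring
    _ = ∫ ξ, ∫ x, Complex.exp ((2 * π * x * ξ + τ x * (ξ * |ξ|) : ℝ) * Complex.I) *
          (F x * (((|ξ| ^ (-(1 / 4) : ℝ) : ℝ) : ℂ) * g ξ)) := integral_integral_swap hint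
    _ = _ := by
        refine integral_congr_ae (ae_of_all _ fun ξ => ?_)
        simp only
        rw [← integral_const_mul]
        refine integral_congr_ae (ae_of_all _ fun x => ?_)
        simp only
        ring

lemma sq_le_of_le_rpow_half_mul {A N c : ℝ} (hA : 0 < A) (hN : 0 ≤ N) (hc : 0 ≤ c)
    (h : ENNReal.ofReal A ≤ ENNReal.ofReal N ^ (1 / 2 : ℝ) *
      ENNReal.ofReal (c * (A * √A)) ^ (1 / 2 : ℝ)) : A ≤ (c * N) ^ 2 := by
  have hs := Real.sqrt_pos.2 hA
  have hAA : √A ^ 2 = A := Real.sq_sqrt hA.le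
  rw [ENNReal.ofReal_rpow_of_nonneg hN (by norm_num),
    ENNReal.ofReal_rpow_of_nonneg (by positivity) (by norm_num),
    ← ENNReal.ofReal_mul (by positivity), ENNReal.ofReal_le_ofReal_iff (by positivity),
    ← Real.mul_rpow hN (by positivity), ← Real.sqrt_eq_rpow,
    Real.le_sqrt hA.le (by positivity)] at h
  have h1 : √A * (A * √A) ≤ c * N * (A * √A) := by
    calc √A * (A * √A) = A * √A ^ 2 := by ring
      _ = A ^ 2 := by rw [hAA]; ring
      _ ≤ _ := h
      _ = _ := by ring
  have h2 : √A ≤ c * N := le_of_mul_le_mul_right h1 (by positivity)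
  calc A = √A ^ 2 := hAA.symm
    _ ≤ _ := pow_le_pow_left₀ hs.le h2 2

set_option maxHeartbeats 1000000 in
lemma lintegral_Icc_smoothedEvolution_le {g : ℝ → ℂ} {τ : ℝ → ℝ} (hgm : Measurable g)
    (hw : Integrable fun ξ => ((|ξ| ^ (-(1 / 4) : ℝ) : ℝ) : ℂ) * g ξ)
    {N : ℝ} (hN : 0 ≤ N) (hgN : ∫⁻ ξ, ‖g ξ‖ₑ ^ 2 ≤ ENNReal.ofReal N) (hτ : Measurable τ) (R : ℝ) :
    ∫⁻ x in Icc (-R) R, ‖smoothedEvolution g x (τ x)‖ₑ ^ 4 ≤ ENNReal.ofReal ((1344 * N) ^ 2) := by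
  set H : ℝ → ℂ := fun x => smoothedEvolution g x (τ x) with hH
  set S : Set ℝ := Icc (-R) R with hS
  set M : ℝ := ∫ ξ, ‖((|ξ| ^ (-(1 / 4) : ℝ) : ℝ) : ℂ) * g ξ‖ with hM
  have mS : MeasurableSet S := measurableSet_Icc
  have mH : Measurable H :=
    (continuous_smoothedEvolution hw).measurable.comp (measurable_id.prodMk hτ)
  have bH : ∀ x, ‖H x‖ ≤ M := fun x => norm_smoothedEvolution_le g x _
  set h : ℝ → ℝ := S.indicator fun x => ‖H x‖ with hh
  set F : ℝ → ℂ := S.indicator fun x => (starRingEnd ℂ) (H x) * ((‖H x‖ ^ 2 : ℝ) : ℂ) with hFdef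
  have mh : Measurable h := mH.norm.indicator mS
  have h0 : ∀ x, 0 ≤ h x := fun x => indicator_nonneg (fun _ _ => norm_nonneg _) x
  have mF : Measurable F := by
    refine Measurable.indicator (Measurable.mul ?_ (by fun_prop)) mS
    exact Complex.continuous_conj.measurable.comp mH
  have hFh : ∀ x, ‖F x‖ = h x ^ 3 := by
    intro x
    by_cases hx : x ∈ S
    · simp only [hFdef, hh, indicator_of_mem hx]
      rw [norm_mul, RCLike.norm_conj, Complex.norm_real, Real.norm_of_nonneg (by positivity)]
      ring
    · simp [hFdef, hh, indicator_of_notMem hx]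
  have hle : ∀ x, h x ≤ M := fun x =>
    (indicator_le_self' (fun _ _ => norm_nonneg _) x).trans (bH x)
  have fin : volume S ≠ ∞ := measure_Icc_lt_top.ne
  have hzero : ∀ x ∉ S, h x = 0 := fun x hx => indicator_of_notMem hx _
  have hFi : Integrable F := by
    have : IntegrableOn F S := Measure.integrableOn_of_bounded (M := M ^ 3) fin
      mF.aestronglyMeasurable (ae_of_all _ fun x => by
        rw [hFh]; exact pow_le_pow_left₀ (h0 x) (hle x) 3)
    refine this.integrable_of_forall_notMem_eq_zero fun x hx => indicator_of_notMem hx _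
  have h4i : Integrable fun x => h x ^ 4 := by
    have : IntegrableOn (fun x => h x ^ 4) S := Measure.integrableOn_of_bounded (M := M ^ 4) fin
      (mh.pow_const 4).aestronglyMeasurable (ae_of_all _ fun x => by
        rw [Real.norm_of_nonneg (pow_nonneg (h0 x) 4)]; exact pow_le_pow_left₀ (h0 x) (hle x) 4)
    refine this.integrable_of_forall_notMem_eq_zero fun x hx => by
      rw [hzero x hx]; norm_num
  set A : ℝ := ∫ x, h x ^ 4 with hAdef
  have hAl : ENNReal.ofReal A = ∫⁻ x, ENNReal.ofReal (h x ^ 4) :=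
    ofReal_integral_eq_lintegral_ofReal h4i (ae_of_all _ fun x => pow_nonneg (h0 x) 4)
  have hgoal : ∫⁻ x in S, ‖H x‖ₑ ^ 4 = ENNReal.ofReal A := by
    rw [hAl, ← lintegral_indicator mS]
    refine lintegral_congr fun x => ?_
    by_cases hx : x ∈ S
    · simp only [hh, indicator_of_mem hx]
      rw [ENNReal.ofReal_pow (norm_nonneg _), ofReal_norm]
    · simp [hh, indicator_of_notMem hx]
  rw [hgoal]
  apply ENNReal.ofReal_le_ofReal
  rcases le_or_gt A 0 with hA | hA
  · exact hA.trans (by positivity)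
  refine sq_le_of_le_rpow_half_mul hA hN (by norm_num) ?_
  set G : ℝ → ℂ := fun ξ => ∫ x, F x *
    Complex.exp ((2 * π * x * ξ + τ x * (ξ * |ξ|) : ℝ) * Complex.I) with hG
  have mG : Measurable G := measurable_oscillatory_integral
    (θ := fun ξ x => 2 * π * x * ξ + τ x * (ξ * |ξ|)) mF (by fun_prop)
  have hAC : (A : ℂ) = ∫ ξ, (((|ξ| ^ (-(1 / 4) : ℝ) : ℝ) : ℂ) * g ξ) * G ξ := by
    rw [← integral_mul_smoothedEvolution hw hFi hτ, hAdef, ← integral_complex_ofReal]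
    refine integral_congr_ae (ae_of_all _ fun x => ?_)
    change ((h x ^ 4 : ℝ) : ℂ) = F x * H x
    by_cases hx : x ∈ S
    · simp only [hFdef, hh, indicator_of_mem hx]
      have := Complex.mul_conj (H x)
      rw [Complex.normSq_eq_norm_sq] at this
      rw [mul_right_comm, mul_comm ((starRingEnd ℂ) (H x)), this]
      push_cast
      ring
    · simp [hFdef, hh, indicator_of_notMem hx]
  have hdual := lintegral_dual_le mF hFi hτ mh h0 hFh hA hAl.ge
  calc ENNReal.ofReal A = ‖(A : ℂ)‖ₑ := by
        rw [← ofReal_norm, Complex.norm_real, Real.norm_of_nonneg hA.le]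
    _ ≤ ∫⁻ ξ, ‖(((|ξ| ^ (-(1 / 4) : ℝ) : ℝ) : ℂ) * g ξ) * G ξ‖ₑ := by
        rw [hAC]; exact enorm_integral_le_lintegral_enorm _
    _ = ∫⁻ ξ, ((fun ξ => ‖g ξ‖ₑ) *
          fun ξ => ‖((|ξ| ^ (-(1 / 4) : ℝ) : ℝ) : ℂ) * G ξ‖ₑ) ξ := by
        refine lintegral_congr fun ξ => ?_
        simp only [Pi.mul_apply, enorm_mul]
        ring
    _ ≤ (∫⁻ ξ, ‖g ξ‖ₑ ^ (2 : ℝ)) ^ (1 / 2 : ℝ) *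
          (∫⁻ ξ, ‖((|ξ| ^ (-(1 / 4) : ℝ) : ℝ) : ℂ) * G ξ‖ₑ ^ (2 : ℝ)) ^ (1 / 2 : ℝ) :=
        ENNReal.lintegral_mul_le_Lp_mul_Lq _ Real.HolderConjugate.two_two
          (by fun_prop) (by fun_prop)
    _ ≤ ENNReal.ofReal N ^ (1 / 2 : ℝ) *
          ENNReal.ofReal (1344 * (A * √A)) ^ (1 / 2 : ℝ) := by
        simp only [ENNReal.rpow_two]
        gcongr
        refine le_trans (le_of_eq (lintegral_congr fun ξ => ?_)) hdual
        rw [← ofReal_norm, ← ENNReal.ofReal_pow (norm_nonneg _), norm_mul, Complex.norm_real,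
          Real.norm_of_nonneg (Real.rpow_nonneg (abs_nonneg ξ) _), mul_pow,
          ← Real.rpow_natCast (|ξ| ^ _), ← Real.rpow_mul (abs_nonneg ξ)]
        have hexp : (-(1 / 4) : ℝ) * ((2 : ℕ) : ℝ) = -(1 / 2) := by norm_num
        rw [hexp]

lemma lintegral_smoothedEvolution_le {g : ℝ → ℂ} {τ : ℝ → ℝ} (hgm : Measurable g)
    (hw : Integrable fun ξ => ((|ξ| ^ (-(1 / 4) : ℝ) : ℝ) : ℂ) * g ξ)
    {N : ℝ} (hN : 0 ≤ N) (hgN : ∫⁻ ξ, ‖g ξ‖ₑ ^ 2 ≤ ENNReal.ofReal N) (hτ : Measurable τ) :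
    ∫⁻ x, ‖smoothedEvolution g x (τ x)‖ₑ ^ 4 ≤ ENNReal.ofReal ((1344 * N) ^ 2) := by
  have hU : (⋃ n : ℕ, Icc (-(n : ℝ)) n) = univ := by
    refine eq_univ_of_forall fun x => mem_iUnion.2 ?_
    obtain ⟨n, hn⟩ := exists_nat_ge |x|
    exact ⟨n, abs_le.1 hn⟩
  have hmono : Monotone fun n : ℕ => Icc (-(n : ℝ)) n := by
    intro n k hnk
    have : (n : ℝ) ≤ k := by exact_mod_cast hnk
    exact Icc_subset_Icc (by linarith) this
  rw [← setLIntegral_univ, ← hU, setLIntegral_iUnion_of_directed _ hmono.directed_le]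
  exact iSup_le fun n => lintegral_Icc_smoothedEvolution_le hgm hw hN hgN hτ n

/-- A point among `q 0, …, q n` maximizing `‖U x (q i)‖`. -/
def runningArgmax (U : ℝ → ℝ → ℂ) (q : ℕ → ℝ) : ℕ → ℝ → ℝ
  | 0, _ => q 0
  | n + 1, x => if ‖U x (runningArgmax U q n x)‖ ≤ ‖U x (q (n + 1))‖ then q (n + 1)
      else runningArgmax U q n x

lemma measurable_runningArgmax {U : ℝ → ℝ → ℂ} (hU : Measurable fun p : ℝ × ℝ => U p.1 p.2)
    (q : ℕ → ℝ) (n : ℕ) : Measurable (runningArgmax U q n) := by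
  induction n with
  | zero => exact measurable_const
  | succ n ih =>
    refine Measurable.ite (measurableSet_le ?_ ?_) measurable_const ih
    · exact (hU.comp (measurable_id.prodMk ih)).norm
    · exact (hU.comp (measurable_id.prodMk measurable_const)).norm

lemma norm_runningArgmax_succ (U : ℝ → ℝ → ℂ) (q : ℕ → ℝ) (n : ℕ) (x : ℝ) :
    ‖U x (runningArgmax U q (n + 1) x)‖ =
      max ‖U x (runningArgmax U q n x)‖ ‖U x (q (n + 1))‖ := by
  simp only [runningArgmax]
  split_ifs with h
  · exact (max_eq_right h).symm
  · exact (max_eq_left (not_le.1 h).le).symm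

lemma norm_le_norm_runningArgmax (U : ℝ → ℝ → ℂ) (q : ℕ → ℝ) (n : ℕ) (x : ℝ) :
    ‖U x (q n)‖ ≤ ‖U x (runningArgmax U q n x)‖ := by
  cases n with
  | zero => exact le_rfl
  | succ n => rw [norm_runningArgmax_succ]; exact le_max_right _ _

/-- A bound for all measurable time selections gives a bound for the full maximal function. -/
lemma lintegral_iSup_enorm_pow_le {U : ℝ → ℝ → ℂ} (hU : Continuous fun p : ℝ × ℝ => U p.1 p.2)
    {B : ℝ≥0∞} (hB : ∀ τ : ℝ → ℝ, Measurable τ → ∫⁻ x, ‖U x (τ x)‖ₑ ^ 4 ≤ B) :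
    ∫⁻ x, (⨆ t, ‖U x t‖ₑ) ^ 4 ≤ B := by
  obtain ⟨q, hq⟩ := TopologicalSpace.exists_dense_seq ℝ
  set τ := runningArgmax U q with hτ
  have mτ : ∀ n, Measurable (τ n) := measurable_runningArgmax hU.measurable q
  have hmono : Monotone fun n x => ‖U x (τ n x)‖ₑ ^ 4 := by
    refine monotone_nat_of_le_succ fun n x => ?_
    simp only
    gcongr
    rw [enorm_le_iff_norm_le, norm_runningArgmax_succ]
    exact le_max_left _ _
  have hpt : ∀ x, (⨆ t, ‖U x t‖ₑ) ^ 4 ≤ ⨆ n, ‖U x (τ n x)‖ₑ ^ 4 := by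
    intro x
    have h4 : (⨆ n, ‖U x (τ n x)‖ₑ) ^ 4 = ⨆ n, ‖U x (τ n x)‖ₑ ^ 4 :=
      Monotone.map_iSup_of_continuousAt (f := fun y : ℝ≥0∞ => y ^ 4)
        (ENNReal.continuous_pow 4).continuousAt (fun a b hab => pow_le_pow_left' hab 4) (by simp)
    rw [← h4]
    gcongr
    refine iSup_le fun t => ?_
    have hc : Continuous fun t => ‖U x t‖ₑ :=
      (hU.comp (by fun_prop : Continuous fun t : ℝ => (x, t))).enorm
    refine hq.induction_on (p := fun t => ‖U x t‖ₑ ≤ ⨆ n, ‖U x (τ n x)‖ₑ) t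
      (isClosed_le hc continuous_const) fun n => ?_
    refine le_trans ?_ (le_iSup _ n)
    rw [enorm_le_iff_norm_le]
    exact norm_le_norm_runningArgmax U q n x
  calc ∫⁻ x, (⨆ t, ‖U x t‖ₑ) ^ 4 ≤ ∫⁻ x, ⨆ n, ‖U x (τ n x)‖ₑ ^ 4 := lintegral_mono hpt
    _ = ⨆ n, ∫⁻ x, ‖U x (τ n x)‖ₑ ^ 4 := by
        refine lintegral_iSup (fun n => ?_) hmono
        exact ((hU.measurable.comp (measurable_id.prodMk (mτ n))).enorm).pow_const 4
    _ ≤ B := iSup_le fun n => hB _ (mτ n)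

lemma integrable_abs_rpow_mul (φ : SchwartzMap ℝ ℂ) :
    Integrable fun ξ : ℝ => ((|ξ| ^ (-(1 / 4) : ℝ) : ℝ) : ℂ) * φ ξ := by
  have hm : AEStronglyMeasurable (fun ξ : ℝ => ((|ξ| ^ (-(1 / 4) : ℝ) : ℝ) : ℂ) * φ ξ) :=
    Measurable.aestronglyMeasurable
      (Measurable.mul (by fun_prop) φ.continuous.measurable)
  obtain ⟨C, hC⟩ : ∃ C, ∀ ξ, ‖φ ξ‖ ≤ C := by
    obtain ⟨C, -, hC⟩ := φ.decay 0 0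
    exact ⟨C, fun ξ => by simpa using hC ξ⟩
  have hi0 : IntegrableOn (fun ξ : ℝ => |ξ| ^ (-(1 / 4) : ℝ)) (Icc (-1) 1) := by
    have h1 : IntegrableOn (fun ξ : ℝ => ξ ^ (-(1 / 4) : ℝ)) (Ioc 0 1) := by
      rw [← intervalIntegrable_iff_integrableOn_Ioc_of_le zero_le_one]
      exact intervalIntegral.intervalIntegrable_rpow' (by norm_num)
    have h2 : Integrable ((Ioc (0 : ℝ) 1).indicator fun ξ : ℝ => ξ ^ (-(1 / 4) : ℝ)) :=
      h1.integrable_indicator measurableSet_Ioc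
    refine (h2.add h2.comp_neg).integrableOn.congr ?_
    refine (ae_restrict_iff' measurableSet_Icc).2 (ae_of_all _ fun ξ hξ => ?_)
    rcases lt_trichotomy ξ 0 with h | h | h
    · have h3 : ξ ∉ Ioc (0 : ℝ) 1 := fun h' => by linarith [h'.1]
      have h4 : -ξ ∈ Ioc (0 : ℝ) 1 := ⟨by linarith, by linarith [hξ.1]⟩
      simp [indicator_of_notMem h3, indicator_of_mem h4, abs_of_neg h]
    · subst h
      simp
    · have h3 : -ξ ∉ Ioc (0 : ℝ) 1 := fun h' => by linarith [h'.1]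
      have h4 : ξ ∈ Ioc (0 : ℝ) 1 := ⟨h, hξ.2⟩
      simp [indicator_of_notMem h3, indicator_of_mem h4, abs_of_pos h]
  have hi1 : IntegrableOn (fun ξ : ℝ => |ξ| ^ (-(1 / 4) : ℝ) * C) (Icc (-1) 1) := hi0.mul_const C
  have hi0' := hi1.integrable_indicator measurableSet_Icc
  refine (hi0'.add φ.integrable.norm).mono' hm (ae_of_all _ fun ξ => ?_)
  rw [norm_mul, Complex.norm_real, Real.norm_of_nonneg (Real.rpow_nonneg (abs_nonneg ξ) _)]
  have hr : 0 ≤ |ξ| ^ (-(1 / 4) : ℝ) := Real.rpow_nonneg (abs_nonneg ξ) _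
  by_cases hξ : ξ ∈ Icc (-1 : ℝ) 1
  · simp only [Pi.add_apply, indicator_of_mem hξ]
    have := mul_le_mul_of_nonneg_left (hC ξ) hr
    have := norm_nonneg (φ ξ)
    linarith
  · simp only [Pi.add_apply, indicator_of_notMem hξ, zero_add]
    have h1 : 1 ≤ |ξ| := by
      by_contra! h
      exact hξ (abs_le.1 h.le)
    exact mul_le_of_le_one_left (norm_nonneg _)
      (Real.rpow_le_one_of_one_le_of_nonpos h1 (by norm_num))

lemma continuous_BO_symbol_mul (φ : SchwartzMap ℝ ℂ) (t : ℝ) :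
    Continuous fun ξ : ℝ => Complex.exp (Complex.I * (t * ξ * |ξ|)) * 𝓕 (⇑φ) ξ := by
  rw [← SchwartzMap.fourier_coe]
  have := (𝓕 φ).continuous
  fun_prop

lemma integrable_BO_symbol_mul (φ : SchwartzMap ℝ ℂ) (t : ℝ) :
    Integrable fun ξ : ℝ => Complex.exp (Complex.I * (t * ξ * |ξ|)) * 𝓕 (⇑φ) ξ := by
  rw [← SchwartzMap.fourier_coe]
  refine (𝓕 φ).integrable.bdd_mul (c := 1) (Continuous.aestronglyMeasurable (by fun_prop))
    (ae_of_all _ fun ξ => ?_)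
  have : Complex.I * (t * ξ * |ξ|) = ((t * ξ * |ξ| : ℝ) : ℂ) * Complex.I := by push_cast; ring
  rw [this, Complex.norm_exp_ofReal_mul_I]

/-- Either the free evolution at time `t` is integrable and Fourier inversion applies, or its
Fourier transform is zero by convention; the bound holds in both cases. -/
lemma enorm_Dop_BOGroup_le (φ : SchwartzMap ℝ ℂ) (x t : ℝ) :
    ‖Dop (-(1 / 4)) (BOGroup t ⇑φ) x‖ₑ ≤ ‖smoothedEvolution (𝓕 (⇑φ)) x t‖ₑ := by
  have hc := continuous_BO_symbol_mul φ t
  have hi := integrable_BO_symbol_mul φ t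
  by_cases hI : Integrable (BOGroup t ⇑φ)
  · have hinv : 𝓕 (BOGroup t ⇑φ) =
        fun ξ : ℝ => Complex.exp (Complex.I * (t * ξ * |ξ|)) * 𝓕 (⇑φ) ξ := by
      refine hc.fourier_fourierInv_eq hi ?_
      have h1 : (𝓕⁻ fun ξ : ℝ => Complex.exp (Complex.I * (t * ξ * |ξ|)) * 𝓕 (⇑φ) ξ) =
          fun x => 𝓕 (fun ξ : ℝ => Complex.exp (Complex.I * (t * ξ * |ξ|)) * 𝓕 (⇑φ) ξ) (-x) := by
        ext x; exact Real.fourierInv_eq_fourier_neg _ x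
      have h2 : Integrable fun x =>
          𝓕 (fun ξ : ℝ => Complex.exp (Complex.I * (t * ξ * |ξ|)) * 𝓕 (⇑φ) ξ) (-x) := by
        rw [← h1]; exact hI
      simpa using h2.comp_neg
    refine le_of_eq ?_
    congr 1
    simp only [Dop, FMul] at hinv ⊢
    rw [hinv, Real.fourierInv_eq']
    refine integral_congr_ae (ae_of_all _ fun ξ => ?_)
    have he : Complex.exp ((2 * π * x * ξ + t * (ξ * |ξ|) : ℝ) * Complex.I) =
        Complex.exp (((2 * π * inner ℝ ξ x : ℝ) : ℂ) * Complex.I) *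
          Complex.exp (Complex.I * (t * ξ * |ξ|)) := by
      rw [← Complex.exp_add]
      congr 1
      simp only [RCLike.inner_apply, conj_trivial]
      push_cast
      ring
    simp only [smul_eq_mul]
    rw [he]
    ring
  · have h0 : 𝓕 (BOGroup t ⇑φ) = 0 := by
      ext ξ
      rw [Real.fourier_eq']
      refine integral_undef fun h => hI ?_
      have := h.bdd_mul (c := 1)
        (f := fun v : ℝ => Complex.exp (((2 * π * inner ℝ v ξ : ℝ) : ℂ) * Complex.I))
        (Continuous.aestronglyMeasurable (by fun_prop))
        (ae_of_all _ fun v => by rw [Complex.norm_exp_ofReal_mul_I])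
      refine this.congr (ae_of_all _ fun v => ?_)
      simp only [smul_eq_mul]
      rw [← mul_assoc, ← Complex.exp_add]
      simp
    have : Dop (-(1 / 4)) (BOGroup t ⇑φ) x = 0 := by
      simp only [Dop, FMul]
      rw [h0, Real.fourierInv_eq']
      simp
    rw [this, enorm_zero]
    exact zero_le

lemma eLpNorm_pow_eq_lintegral {E : Type*} [NormedAddCommGroup E] {f : ℝ → E} (n : ℕ) (hn : n ≠ 0) :
    eLpNorm f n volume ^ n = ∫⁻ x, ‖f x‖ₑ ^ n := by
  have := eLpNorm_nnreal_pow_eq_lintegral (f := f) (μ := volume) (p := (n : ℝ≥0))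
    (by exact_mod_cast hn)
  simpa using this

lemma lintegral_enorm_fourier_sq (φ : SchwartzMap ℝ ℂ) :
    ∫⁻ ξ, ‖𝓕 (⇑φ) ξ‖ₑ ^ 2 = eLpNorm ⇑φ 2 volume ^ 2 := by
  have h : eLpNorm ⇑(𝓕 φ : SchwartzMap ℝ ℂ) 2 volume = eLpNorm ⇑φ 2 volume := by
    have := φ.norm_fourier_toL2_eq
    rwa [SchwartzMap.norm_toLp, SchwartzMap.norm_toLp, ENNReal.toReal_eq_toReal_iff'
      ((𝓕 φ : SchwartzMap ℝ ℂ).eLpNorm_lt_top 2 volume).ne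
      (φ.eLpNorm_lt_top 2 volume).ne] at this
  rw [← h, SchwartzMap.fourier_coe]
  exact (eLpNorm_pow_eq_lintegral 2 two_ne_zero).symm

lemma lintegral_iSup_smoothedEvolution_le (φ : SchwartzMap ℝ ℂ) :
    ∫⁻ x, (⨆ t, ‖smoothedEvolution (𝓕 (⇑φ)) x t‖ₑ) ^ 4 ≤
      ENNReal.ofReal ((1344 * (eLpNorm ⇑φ 2 volume).toReal ^ 2) ^ 2) := by
  have hN : eLpNorm ⇑φ 2 volume ^ 2 =
      ENNReal.ofReal ((eLpNorm ⇑φ 2 volume).toReal ^ 2) := by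
    rw [ENNReal.ofReal_pow ENNReal.toReal_nonneg,
      ENNReal.ofReal_toReal (φ.eLpNorm_lt_top 2 volume).ne]
  have hw : Integrable fun ξ => ((|ξ| ^ (-(1 / 4) : ℝ) : ℝ) : ℂ) * 𝓕 (⇑φ) ξ := by
    rw [← SchwartzMap.fourier_coe]; exact integrable_abs_rpow_mul (𝓕 φ)
  have hgm : Measurable (𝓕 (⇑φ)) := by
    rw [← SchwartzMap.fourier_coe]; exact (𝓕 φ).continuous.measurable
  exact lintegral_iSup_enorm_pow_le (continuous_smoothedEvolution hw) fun τ hτ =>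
    lintegral_smoothedEvolution_le hgm hw (sq_nonneg _)
      ((lintegral_enorm_fourier_sq φ).trans hN).le hτ

/-- The `L^4_x L^∞_T` norm is controlled by any pointwise majorant of the slices. -/
lemma LpLq_four_top_pow_le {f : ℝ → ℝ → ℂ} {T : ℝ} {k : ℝ → ℝ≥0∞}
    (hfk : ∀ x t, ‖f x t‖ₑ ≤ k x) : LpLq 4 ∞ T f ^ 4 ≤ ∫⁻ x, k x ^ 4 := by
  have h := eLpNorm_pow_eq_lintegral (f := fun x => (eLpNorm (fun t => f x t) ∞
    (volume.restrict (Ioc (0 : ℝ) T))).toReal) 4 (by norm_num)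
  rw [Nat.cast_ofNat] at h
  unfold LpLq
  rw [h]
  refine lintegral_mono fun x => pow_le_pow_left' ?_ 4
  rw [Real.enorm_of_nonneg ENNReal.toReal_nonneg]
  refine ENNReal.ofReal_toReal_le.trans ?_
  rw [eLpNorm_exponent_top]
  exact eLpNormEssSup_le_of_ae_enorm_bound (ae_of_all _ fun t => hfk x t)

/-- **Maximal-in-time estimate for the Benjamin–Ono group.**
For every `φ ∈ 𝒮(ℝ)` and every `T > 0`,
`‖D_x^{-1/4} V(t) φ‖_{L^4_x L^∞_T} ≲ ‖φ‖_{L²}`, with implicit constant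
independent of `φ` and `T`. -/
theorem maximal_in_time_BO :
    ∃ C : ℝ≥0, 0 < C ∧ ∀ (φ : SchwartzMap ℝ ℂ) (T : ℝ), 0 < T →
      LpLq 4 ∞ T (fun x t => Dop (-(1/4)) (BOGroup t ⇑φ) x)
        ≤ C * eLpNorm ⇑φ 2 volume := by
  refine ⟨37, by norm_num, fun φ T _ => ?_⟩
  refine (ENNReal.pow_le_pow_left_iff (n := 4) (by norm_num)).1 ?_
  refine (LpLq_four_top_pow_le fun x t => (enorm_Dop_BOGroup_le φ x t).trans
    (le_iSup (fun t => ‖smoothedEvolution (𝓕 (⇑φ)) x t‖ₑ) t)).trans ?_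
  refine (lintegral_iSup_smoothedEvolution_le φ).trans ?_
  have hE : eLpNorm ⇑φ 2 volume ≠ ∞ := (φ.eLpNorm_lt_top 2 volume).ne
  generalize eLpNorm ⇑φ 2 volume = E at hE ⊢
  lift E to ℝ≥0 using hE
  rw [ENNReal.coe_toReal]
  refine (ENNReal.ofReal_le_ofReal (q := ((37 * E : ℝ≥0) : ℝ) ^ 4) ?_).trans ?_
  · have : 0 ≤ (E : ℝ) ^ 4 := by positivity
    push_cast
    nlinarith
  · rw [ENNReal.ofReal_pow (NNReal.coe_nonneg _), ENNReal.ofReal_coe_nnreal, ENNReal.coe_mul]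

end
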